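/- arXiv:1004.0905 — 4 statements merged into one kernel-verified Lean document; each statement's English description precedes it below -/
import Mathlib

section
/- Let n ≥ 1, let C be a symmetric positive definite real n×n matrix, let μ, a ∈ ℝⁿ with μ ≠ 0 and aᵀ C⁻¹ μ > 0, and let B > 0 and r > 0. Define the tangent point q_t = (r B / √(μᵀ C⁻¹ μ)) · C⁻¹ μ. Then the total amount of invested money is aᵀ q_t = r B · (aᵀ C⁻¹ μ) / √(μᵀ C⁻¹ μ), and aᵀ q_t < B if and only if r² < (μᵀ C⁻¹ μ) / (aᵀ C⁻¹ μ)². In particular this threshold, the border risk r_b² = (μᵀ C⁻¹ μ) / (aᵀ C⁻¹ μ)², does not depend on the budget B. -/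
open Matrix

/-- With `C` symmetric positive definite, `μ ≠ 0`, `aᵀ C⁻¹ μ > 0`,
`B > 0`, `r > 0`, the tangent point `q_t = (r B / √(μᵀ C⁻¹ μ)) • C⁻¹ μ`
satisfies `aᵀ q_t = r B (aᵀ C⁻¹ μ)/√(μᵀ C⁻¹ μ)`, and `aᵀ q_t < B` iff
`r² < (μᵀ C⁻¹ μ)/(aᵀ C⁻¹ μ)²`, the border risk, which does not depend on `B`. -/
theorem border_risk_threshold
    (n : ℕ) (hn : 1 ≤ n)
    (C : Matrix (Fin n) (Fin n) ℝ) (hC : C.PosDef)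
    (μ a : Fin n → ℝ) (hμ : μ ≠ 0)
    (haC : 0 < a ⬝ᵥ C⁻¹ *ᵥ μ)
    (B r : ℝ) (hB : 0 < B) (hr : 0 < r) :
    let qt : Fin n → ℝ := (r * B / Real.sqrt (μ ⬝ᵥ C⁻¹ *ᵥ μ)) • (C⁻¹ *ᵥ μ)
    a ⬝ᵥ qt = r * B * (a ⬝ᵥ C⁻¹ *ᵥ μ) / Real.sqrt (μ ⬝ᵥ C⁻¹ *ᵥ μ) ∧
    (a ⬝ᵥ qt < B ↔ r ^ 2 < (μ ⬝ᵥ C⁻¹ *ᵥ μ) / (a ⬝ᵥ C⁻¹ *ᵥ μ) ^ 2) := by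
  intro qt
  have hS : 0 < μ ⬝ᵥ C⁻¹ *ᵥ μ := by
    simpa using hC.inv.dotProduct_mulVec_pos hμ
  have hqt : a ⬝ᵥ qt = r * B * (a ⬝ᵥ C⁻¹ *ᵥ μ) / Real.sqrt (μ ⬝ᵥ C⁻¹ *ᵥ μ) := by
    simp only [qt, dotProduct_smul, smul_eq_mul]
    ring
  refine ⟨hqt, ?_⟩
  rw [hqt, div_lt_iff₀ (Real.sqrt_pos.2 hS), lt_div_iff₀ (pow_pos haC 2), ← mul_pow,
    ← Real.lt_sqrt (mul_pos hr haC).le, mul_right_comm, mul_comm _ B, mul_lt_mul_iff_right₀ hB]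
end

section
/- Let n ≥ 1, let C be a symmetric positive definite real n×n matrix, let μ ∈ ℝⁿ be nonzero such that every component of C⁻¹ μ is positive, and let a ∈ ℝⁿ have all components positive. Let B > 0 and let r > 0 satisfy r² < r_b² := (μᵀ C⁻¹ μ) / (aᵀ C⁻¹ μ)². Then the point q_t = (r B / √(μᵀ C⁻¹ μ)) · C⁻¹ μ has all components positive, satisfies q_tᵀ C q_t = B² r² and aᵀ q_t < B, and q_t maximizes μᵀ x over the feasible region { x ∈ ℝⁿ : x ≥ 0, aᵀ x ≤ B, xᵀ C x ≤ B² r² }. Hence for risks below the border risk r_b² the optimal investment does not exhaust the budget. -/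
open Matrix

/-- Over the ellipsoid through `t • v`, the linear functional normal to it at that point is
maximized there. -/
theorem Matrix.PosSemidef.dotProduct_mulVec_le_smul {ι : Type*} [Fintype ι]
    {C : Matrix ι ι ℝ} (hC : C.PosSemidef) {x v : ι → ℝ} {t : ℝ} (ht : 0 < t)
    (hx : x ⬝ᵥ C *ᵥ x ≤ t ^ 2 * (v ⬝ᵥ C *ᵥ v)) :
    x ⬝ᵥ C *ᵥ v ≤ t * (v ⬝ᵥ C *ᵥ v) := by
  have hsymm : v ⬝ᵥ C *ᵥ x = x ⬝ᵥ C *ᵥ v := by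
    have hT : Cᵀ = C := by simpa using hC.isHermitian.eq
    rw [dotProduct_mulVec, dotProduct_comm, ← mulVec_transpose, hT]
  have hnonneg : 0 ≤ (x - t • v) ⬝ᵥ C *ᵥ (x - t • v) := by
    simpa using hC.dotProduct_mulVec_nonneg (x - t • v)
  simp only [mulVec_sub, mulVec_smul, sub_dotProduct, dotProduct_sub, smul_dotProduct,
    dotProduct_smul, smul_eq_mul, hsymm] at hnonneg
  refine le_of_mul_le_mul_left ?_ ht
  linarith

/-- If every component of `C⁻¹ μ` is positive, all prices are
positive, and the risk is below the border risk
`r_b² = (μᵀ C⁻¹ μ)/(aᵀ C⁻¹ μ)²`, then the tangent point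
`q_t = (r B / √(μᵀ C⁻¹ μ)) • C⁻¹ μ` has positive components, lies on the
quadric `q_tᵀ C q_t = B² r²`, does not exhaust the budget (`aᵀ q_t < B`),
and maximizes the return `μᵀ x` over the whole feasible region. -/
theorem below_border_risk_optimum
    (n : ℕ) (hn : 1 ≤ n)
    (C : Matrix (Fin n) (Fin n) ℝ) (hC : C.PosDef)
    (μ a : Fin n → ℝ) (hμ : μ ≠ 0)
    (hCμ : ∀ i, 0 < (C⁻¹ *ᵥ μ) i)
    (ha : ∀ i, 0 < a i)
    (B r : ℝ) (hB : 0 < B) (hr : 0 < r)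
    (hrisk : r ^ 2 < (μ ⬝ᵥ C⁻¹ *ᵥ μ) / (a ⬝ᵥ C⁻¹ *ᵥ μ) ^ 2) :
    let qt : Fin n → ℝ := (r * B / Real.sqrt (μ ⬝ᵥ C⁻¹ *ᵥ μ)) • (C⁻¹ *ᵥ μ)
    (∀ i, 0 < qt i) ∧
    qt ⬝ᵥ C *ᵥ qt = B ^ 2 * r ^ 2 ∧
    a ⬝ᵥ qt < B ∧
    (∀ x : Fin n → ℝ, (∀ i, 0 ≤ x i) → a ⬝ᵥ x ≤ B →
      x ⬝ᵥ C *ᵥ x ≤ B ^ 2 * r ^ 2 → μ ⬝ᵥ x ≤ μ ⬝ᵥ qt) := by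
  have hinv : C *ᵥ (C⁻¹ *ᵥ μ) = μ := by
    rw [mulVec_mulVec, mul_nonsing_inv _ ((isUnit_iff_isUnit_det C).mp hC.isUnit), one_mulVec]
  generalize C⁻¹ *ᵥ μ = v at *
  have hs : 0 < μ ⬝ᵥ v := by
    have hv : v ≠ 0 := by
      rintro rfl
      exact hμ (by simpa using hinv.symm)
    have hpos := hC.dotProduct_mulVec_pos hv
    rw [hinv, dotProduct_comm] at hpos
    simpa using hpos
  have hav : 0 < a ⬝ᵥ v :=
    Finset.sum_pos (fun i _ => mul_pos (ha i) (hCμ i)) ⟨⟨0, hn⟩, Finset.mem_univ _⟩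
  have hsqrt : 0 < √(μ ⬝ᵥ v) := Real.sqrt_pos.mpr hs
  have hquad : v ⬝ᵥ C *ᵥ v = μ ⬝ᵥ v := by rw [hinv, dotProduct_comm]
  have ht : 0 < r * B / √(μ ⬝ᵥ v) := by positivity
  have ht_sq : (r * B / √(μ ⬝ᵥ v)) ^ 2 * (μ ⬝ᵥ v) = B ^ 2 * r ^ 2 := by
    rw [div_pow, Real.sq_sqrt hs.le, div_mul_cancel₀ _ hs.ne']
    ring
  refine ⟨fun i => mul_pos ht (hCμ i), ?_, ?_, fun x _ _ hx => ?_⟩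
  · rw [mulVec_smul, smul_dotProduct, dotProduct_smul, hquad, ← ht_sq]
    simp only [smul_eq_mul]
    ring
  · have hlt : r * (a ⬝ᵥ v) < √(μ ⬝ᵥ v) := by
      apply Real.lt_sqrt_of_sq_lt
      rwa [mul_pow, ← lt_div_iff₀ (by positivity)]
    rw [dotProduct_smul, smul_eq_mul, div_mul_eq_mul_div, div_lt_iff₀ hsqrt]
    calc r * B * (a ⬝ᵥ v) = B * (r * (a ⬝ᵥ v)) := by ring
      _ < B * √(μ ⬝ᵥ v) := mul_lt_mul_of_pos_left hlt hB
  · have hle := hC.posSemidef.dotProduct_mulVec_le_smul (x := x) (v := v) ht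
      (by rwa [hquad, ht_sq])
    rwa [hquad, hinv, dotProduct_comm, ← smul_eq_mul, ← dotProduct_smul] at hle
end

section
/- Let n ≥ 1, let Q be a symmetric positive definite real n×n matrix, let s > 0, and let ñ ∈ ℝⁿ be nonzero. Set c = √(s · ñᵀ Q⁻¹ ñ). Then every x ∈ ℝⁿ with xᵀ Q x ≤ s satisfies ñᵀ x ≤ c, and therefore the closed half-space { x : ñᵀ x ≤ ⌈c⌉ } contains the whole region { x : xᵀ Q x ≤ s }; i.e., the rounded linear cut ñᵀ x ≤ ⌈c⌉ is valid for the quadratic region. -/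
open Matrix

/-- Cauchy–Schwarz inequality for the dual pair of quadratic forms given by a positive definite
matrix and its inverse. -/
theorem Matrix.PosDef.sq_dotProduct_le {ι : Type*} [Fintype ι] [DecidableEq ι]
    {Q : Matrix ι ι ℝ} (hQ : Q.PosDef) (v x : ι → ℝ) :
    (v ⬝ᵥ x) ^ 2 ≤ (x ⬝ᵥ Q *ᵥ x) * (v ⬝ᵥ Q⁻¹ *ᵥ v) := by
  have hdet : IsUnit Q.det := (Matrix.isUnit_iff_isUnit_det Q).mp hQ.isUnit
  have hQy : Q *ᵥ (Q⁻¹ *ᵥ v) = v := by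
    rw [mulVec_mulVec, mul_nonsing_inv _ hdet, one_mulVec]
  have hsymm : Qᵀ = Q := by simpa using hQ.isHermitian.eq
  have hyx : (Q⁻¹ *ᵥ v) ⬝ᵥ Q *ᵥ x = v ⬝ᵥ x := by
    rw [dotProduct_mulVec, ← mulVec_transpose, hsymm, hQy]
  have hnonneg : ∀ t : ℝ, 0 ≤ (x ⬝ᵥ Q *ᵥ x) * (t * t) + (-2 * (v ⬝ᵥ x)) * t
      + v ⬝ᵥ Q⁻¹ *ᵥ v := by
    intro t
    have h := hQ.posSemidef.dotProduct_mulVec_nonneg (t • x - Q⁻¹ *ᵥ v)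
    simp only [star_trivial, mulVec_sub, mulVec_smul, hQy, sub_dotProduct, dotProduct_sub,
      smul_dotProduct, dotProduct_smul, hyx, smul_eq_mul] at h
    rw [dotProduct_comm x v, dotProduct_comm (Q⁻¹ *ᵥ v) v] at h
    linarith
  have h := discrim_le_zero hnonneg
  rw [discrim] at h
  linarith

/-- For `Q` symmetric positive definite, `s > 0` and a nonzero
integer-rounded normal vector `ñ`, setting `c = √(s · ñᵀ Q⁻¹ ñ)`, every point of
the quadratic region `{x : xᵀ Q x ≤ s}` satisfies `ñᵀ x ≤ c`, hence also the
rounded cut `ñᵀ x ≤ ⌈c⌉`; i.e. the half-space contains the whole region. -/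
theorem rounded_tangent_cut_valid
    (n : ℕ) (hn : 1 ≤ n)
    (Q : Matrix (Fin n) (Fin n) ℝ) (hQ : Q.PosDef)
    (s : ℝ) (hs : 0 < s)
    (nt : Fin n → ℝ) (hnt : nt ≠ 0) :
    let c : ℝ := Real.sqrt (s * (nt ⬝ᵥ Q⁻¹ *ᵥ nt))
    ∀ x : Fin n → ℝ, x ⬝ᵥ Q *ᵥ x ≤ s →
      nt ⬝ᵥ x ≤ c ∧ nt ⬝ᵥ x ≤ (⌈c⌉ : ℝ) := by
  intro c x hx
  have hd : 0 ≤ nt ⬝ᵥ Q⁻¹ *ᵥ nt := by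
    simpa using hQ.inv.posSemidef.dotProduct_mulVec_nonneg nt
  have hc : nt ⬝ᵥ x ≤ c :=
    Real.le_sqrt_of_sq_le ((hQ.sq_dotProduct_le nt x).trans (by gcongr))
  exact ⟨hc, hc.trans (Int.le_ceil c)⟩
end

section
/- Let a = (6075, 3105), μ = (12500, 10000), B = 9·10⁶, r² = 3·10⁻⁵, and let Ω be the symmetric positive definite 2×2 matrix with entries Ω₁₁ = 0.832843·10⁻⁴, Ω₁₂ = Ω₂₁ = 0.485325·10⁻⁴, Ω₂₂ = 0.651298·10⁻³. Define Q(x) = (a₁x₁, a₂x₂) Ω (a₁x₁, a₂x₂)ᵀ. Then the integer point x* = (779, 207) satisfies a₁x₁ + a₂x₂ ≤ B and Q(x*) ≤ B² r², and for every pair of nonnegative integers (x₁, x₂) with a₁x₁ + a₂x₂ ≤ B and Q(x₁,x₂) ≤ B² r², one has 12500·x₁ + 10000·x₂ ≤ 12500·779 + 10000·207 = 11807500; i.e., x* is an optimal integer portfolio with return 11807500. -/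
/-- The quadratic risk form `Q(x) = (a₁x₁, a₂x₂) Ω (a₁x₁, a₂x₂)ᵀ` of the
illustrative example, with prices `a = (6075, 3105)` and covariance matrix
`Ω₁₁ = 0.832843·10⁻⁴`, `Ω₁₂ = Ω₂₁ = 0.485325·10⁻⁴`, `Ω₂₂ = 0.651298·10⁻³`. -/
noncomputable def exampleRisk (x1 x2 : ℝ) : ℝ :=
  (832843 / 10 ^ 10) * (6075 * x1) ^ 2
    + 2 * (485325 / 10 ^ 10) * (6075 * x1) * (3105 * x2)
    + (651298 / 10 ^ 9) * (3105 * x2) ^ 2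

/-- The risk constraint alone bounds the return: the form `exampleRisk` dominates a multiple of
`(5 * x1 + 4 * x2) ^ 2`, up to the square of a linear form vanishing at the continuous optimum. -/
theorem lt_of_exampleRisk_le {x1 x2 : ℝ}
    (h : exampleRisk x1 x2 ≤ (9000000 : ℝ) ^ 2 * (3 / 100000)) : 5 * x1 + 4 * x2 < 4724 := by
  unfold exampleRisk at h
  by_contra! hs
  have hsq : (4724 : ℝ) ^ 2 ≤ (5 * x1 + 4 * x2) ^ 2 := by gcongr
  linarith [sq_nonneg (x2 - 169378857 / 3721032748 * (5 * x1 + 4 * x2))]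

/-- With budget `B = 9·10⁶` and risk `r² = 3·10⁻⁵`, the integer
point `x* = (779, 207)` is feasible (budget and risk constraints) and optimal:
every feasible pair of nonnegative integers has return
`12500·x₁ + 10000·x₂ ≤ 12500·779 + 10000·207 = 11807500`. -/
theorem example_portfolio_optimum :
    (6075 * 779 + 3105 * 207 : ℝ) ≤ 9000000 ∧
    exampleRisk 779 207 ≤ (9000000 : ℝ) ^ 2 * (3 / 100000) ∧
    (12500 * 779 + 10000 * 207 : ℝ) = 11807500 ∧
    (∀ x1 x2 : ℕ, (6075 * (x1 : ℝ) + 3105 * (x2 : ℝ)) ≤ 9000000 →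
      exampleRisk (x1 : ℝ) (x2 : ℝ) ≤ (9000000 : ℝ) ^ 2 * (3 / 100000) →
      12500 * (x1 : ℝ) + 10000 * (x2 : ℝ) ≤ 11807500) := by
  refine ⟨by norm_num, by norm_num [exampleRisk], by norm_num, fun x1 x2 _ hrisk => ?_⟩
  have hlt : 5 * x1 + 4 * x2 < 4724 := by exact_mod_cast lt_of_exampleRisk_le hrisk
  have hle : 5 * (x1 : ℝ) + 4 * x2 ≤ 4723 := by exact_mod_cast Nat.le_of_lt_succ hlt
  linarith
end
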